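/- Let A = (Q, δ, I, F) be a BA, ≼ a direct simulation on A, and # : Q → ℕ a function with #(p) = #(q) iff p and q lie in the same SCC of A and #(p) ≤ #(q) whenever q is reachable from p. For every w ∈ Σ^ω, the run DAG of A over w with respect to the pruning map pr is accepting if and only if the run DAG of A over w with respect to the identity map is accepting. -/

import Mathlib

attribute [local instance] Classical.propDecidable

universe u v w y

/-- Emerson–Lei acceptance conditions over colours `γ`. -/
inductive EL (γ : Type u) : Type u
  | inf : γ → EL γ
  | fin : γ → EL γ
  | conj : EL γ → EL γ → EL γ
  | disj : EL γ → EL γ → EL γ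

/-- Satisfaction of an Emerson–Lei condition by a set `M` of colours. -/
def EL.sat {γ : Type u} (M : Set γ) : EL γ → Prop
  | .inf c => c ∈ M
  | .fin c => c ∉ M
  | .conj φ ψ => φ.sat M ∧ ψ.sat M
  | .disj φ ψ => φ.sat M ∨ ψ.sat M

/-- Renaming of colours in an Emerson–Lei condition. -/
def EL.map {γ : Type u} {γ' : Type v} (f : γ → γ') : EL γ → EL γ'
  | .inf c => .inf (f c)
  | .fin c => .fin (f c)
  | .conj φ ψ => .conj (φ.map f) (ψ.map f)
  | .disj φ ψ => .disj (φ.map f) (ψ.map f)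

/-- A (transition-based) Büchi automaton over alphabet `A` with states `Q`. -/
structure BA (Q : Type u) (A : Type v) where
  delta : Set (Q × A × Q)
  init : Set Q
  F : Set (Q × A × Q)
  F_sub : F ⊆ delta

namespace BA

variable {Q : Type u} {A : Type v}

/-- `δ(S, a)`. -/
def deltaSet (M : BA Q A) (S : Set Q) (a : A) : Set Q :=
  {q | ∃ p ∈ S, (p, a, q) ∈ M.delta}

/-- `δ_F(S, a)`. -/
def deltaF (M : BA Q A) (S : Set Q) (a : A) : Set Q :=
  {q | ∃ p ∈ S, (p, a, q) ∈ M.F}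

/-- `δ(S, u)` for a finite word `u`. -/
def deltaWord (M : BA Q A) (S : Set Q) : List A → Set Q
  | [] => S
  | a :: u => M.deltaWord (M.deltaSet S a) u

/-- A run of the BA on an infinite word. -/
def IsRun (M : BA Q A) (w : ℕ → A) (ρ : ℕ → Q) : Prop :=
  ρ 0 ∈ M.init ∧ ∀ i, (ρ i, w i, ρ (i + 1)) ∈ M.delta

/-- An accepting run of the BA on an infinite word. -/
def AccRun (M : BA Q A) (w : ℕ → A) (ρ : ℕ → Q) : Prop :=
  M.IsRun w ρ ∧ {i | (ρ i, w i, ρ (i + 1)) ∈ M.F}.Infinite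

/-- The language of the BA. -/
def lang (M : BA Q A) : Set (ℕ → A) := {w | ∃ ρ, M.AccRun w ρ}

/-- Completeness of a BA. -/
def Complete (M : BA Q A) : Prop :=
  M.init.Nonempty ∧ ∀ q a, ∃ q', (q, a, q') ∈ M.delta

/-- One transition step (over some symbol). -/
def Step (M : BA Q A) (p q : Q) : Prop := ∃ a, (p, a, q) ∈ M.delta

/-- Reachability. -/
def Reach (M : BA Q A) : Q → Q → Prop := Relation.ReflTransGen M.Step

/-- Mutual reachability, i.e., lying in the same SCC. -/
def SameSCC (M : BA Q A) (p q : Q) : Prop := M.Reach p q ∧ M.Reach q p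

/-- A strongly connected component: a maximal nonempty set of pairwise
mutually reachable states. -/
def IsSCC (M : BA Q A) (C : Set Q) : Prop :=
  C.Nonempty ∧ (∀ p ∈ C, ∀ q ∈ C, M.Reach p q) ∧
    ∀ D, C ⊆ D → (∀ p ∈ D, ∀ q ∈ D, M.Reach p q) → D ⊆ C

/-- An accepting SCC: one containing an accepting transition with both
endpoints in it. -/
def IsAccSCC (M : BA Q A) (C : Set Q) : Prop :=
  M.IsSCC C ∧ ∃ p ∈ C, ∃ a, ∃ q ∈ C, (p, a, q) ∈ M.F

/-- `δ_SCC(S, a)`: restriction of `δ` to transitions staying in one SCC. -/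
def deltaSCC (M : BA Q A) (S : Set Q) (a : A) : Set Q :=
  {q | ∃ p ∈ S, (p, a, q) ∈ M.delta ∧ M.SameSCC p q}

/-- A cycle of length `k > 0` lying inside the set `C`. -/
def IsCycleIn (M : BA Q A) (C : Set Q) (k : ℕ) (ρ : ℕ → Q) (σ : ℕ → A) : Prop :=
  0 < k ∧ ρ 0 = ρ k ∧ ∀ i < k, ρ i ∈ C ∧ (ρ i, σ i, ρ (i + 1)) ∈ M.delta

/-- `C` is inherently weak: every cycle inside `C` contains an accepting
transition, or no cycle inside `C` contains one. -/
def InherentlyWeak (M : BA Q A) (C : Set Q) : Prop :=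
  (∀ k ρ σ, M.IsCycleIn C k ρ σ → ∃ i < k, (ρ i, σ i, ρ (i + 1)) ∈ M.F) ∨
  (∀ k ρ σ, M.IsCycleIn C k ρ σ → ∀ i < k, (ρ i, σ i, ρ (i + 1)) ∉ M.F)

/-- `C` is a deterministic SCC. -/
def DetSCC (M : BA Q A) (C : Set Q) : Prop :=
  ∀ q ∈ C, ∀ a : A, (M.deltaSet {q} a ∩ C).Subsingleton

/-- A partition block: a nonempty union of accepting SCCs. -/
def IsPartitionBlock (M : BA Q A) (P : Set Q) : Prop :=
  P.Nonempty ∧ ∃ Cs : Set (Set Q), (∀ C ∈ Cs, M.IsAccSCC C) ∧ P = ⋃₀ Cs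

/-- `A_P`: accepting transitions restricted to those between states of `P`. -/
def restrict (M : BA Q A) (P : Set Q) : BA Q A where
  delta := M.delta
  init := M.init
  F := M.F ∩ {t | t.1 ∈ P ∧ t.2.2 ∈ P}
  F_sub := fun _ ht => M.F_sub ht.1

end BA

/-- A partitioning of a BA: pairwise disjoint partition blocks containing
all accepting SCCs. -/
def IsPartitioning {Q : Type u} {A : Type v} {n : ℕ} (M : BA Q A)
    (P : Fin n → Set Q) : Prop :=
  (∀ i, M.IsPartitionBlock (P i)) ∧
  (Pairwise fun i j => Disjoint (P i) (P j)) ∧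
  ∀ C, M.IsAccSCC C → ∃ i, C ⊆ P i

/-- A transition-based Emerson–Lei automaton; transitions carry sets of
colours. -/
structure TELA (Q : Type u) (A : Type v) (γ : Type w) where
  trans : Set (Q × A × Set γ × Q)
  init : Set Q
  acc : EL γ

namespace TELA

variable {Q : Type u} {A : Type v} {γ : Type w}

/-- A run of the TELA (state sequence together with emitted colour sets). -/
def IsRun (T : TELA Q A γ) (w : ℕ → A) (ρ : ℕ → Q) (κ : ℕ → Set γ) : Prop :=
  ρ 0 ∈ T.init ∧ ∀ i, (ρ i, w i, κ i, ρ (i + 1)) ∈ T.trans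

/-- The union of colour sets of transitions occurring infinitely often. -/
def infCols (w : ℕ → A) (ρ : ℕ → Q) (κ : ℕ → Set γ) : Set γ :=
  {c | ∃ t : Q × A × Set γ × Q,
    {i | (ρ i, w i, κ i, ρ (i + 1)) = t}.Infinite ∧ c ∈ t.2.2.1}

/-- An accepting run of the TELA. -/
def AccRun (T : TELA Q A γ) (w : ℕ → A) (ρ : ℕ → Q) (κ : ℕ → Set γ) : Prop :=
  T.IsRun w ρ κ ∧ EL.sat (infCols w ρ κ) T.acc

/-- The language of the TELA. -/
def lang (T : TELA Q A γ) : Set (ℕ → A) := {w | ∃ ρ κ, T.AccRun w ρ κ}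

end TELA

/-- A partial complementation instance for a partition block. -/
structure PartialAlg (Q : Type u) (A : Type v) (T : Type w) (γ : Type y) where
  init : Set T
  succ : Set Q → T → A → Set (T × Set γ)
  acc : EL γ

/-- `ModCompl` for a single partial complementation instance. -/
def ModCompl1 {Q : Type u} {A : Type v} {T : Type w} {γ : Type y}
    (M : BA Q A) (alg : PartialAlg Q A T γ) : TELA (Set Q × T) A γ where
  init := {x | x.1 = M.init ∧ x.2 ∈ alg.init}
  trans := {x | ∃ H m a m' α, (m', α) ∈ alg.succ H m a ∧
    x = ((H, m), a, α, (M.deltaSet H a, m'))}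
  acc := alg.acc

/-- Conjunction of a nonempty family of Emerson–Lei conditions. -/
def ELbigAnd {γ : Type u} {n : ℕ} (f : Fin (n + 1) → EL γ) : EL γ :=
  List.foldl EL.conj (f 0) (List.ofFn fun i : Fin n => f i.succ)

/-- The synchronous modular complementation `ModCompl` for several partial
complementation instances; colours are renumbered via `Sigma.mk`. -/
def ModComplN {Q : Type u} {A : Type v} {n : ℕ} {T : Fin (n + 1) → Type w}
    {γ : Fin (n + 1) → Type y} (M : BA Q A)
    (alg : ∀ i, PartialAlg Q A (T i) (γ i)) :
    TELA (Set Q × (∀ i, T i)) A (Σ i, γ i) where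
  init := {x | x.1 = M.init ∧ ∀ i, x.2 i ∈ (alg i).init}
  trans := {x | ∃ (H : Set Q) (m : ∀ i, T i) (a : A) (m' : ∀ i, T i)
      (α : ∀ i, Set (γ i)),
    (∀ i, (m' i, α i) ∈ (alg i).succ H (m i) a) ∧
    x = ((H, m), a, {c : Σ i, γ i | c.2 ∈ α c.1}, (M.deltaSet H a, m'))}
  acc := ELbigAnd fun i => ((alg i).acc).map (Sigma.mk i)

/-- A partial round-robin complementation instance. -/
structure RRAlg (Q : Type u) (A : Type v) (Tt Ta : Type w) (γ : Type y) where
  init : Set Tt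
  succT : Set Q → Tt → A → Set (Tt × Set γ)
  succA : Set Q → Ta → A → Set ((Tt ⊕ Ta) × Set γ)
  lift : Tt → Set Ta
  acc : EL γ

/-- The flattening `algunion` of a partial round-robin instance. -/
def RRAlg.flatten {Q : Type u} {A : Type v} {Tt Ta : Type w} {γ : Type y}
    (R : RRAlg Q A Tt Ta γ) : PartialAlg Q A (Tt ⊕ Ta) γ where
  init := Sum.inl '' R.init
  succ := fun H m a =>
    match m with
    | Sum.inr mA => R.succA H mA a
    | Sum.inl mT =>
        {x | ∃ p ∈ R.succT H mT a, x = (Sum.inl p.1, p.2)} ∪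
        {x | ∃ p ∈ R.succT H mT a, ∃ m'' ∈ R.lift p.1, x = (Sum.inr m'', p.2)}
  acc := R.acc

/-- Consistency (conditions (C1)–(C3)) of a partial round-robin instance with
respect to a BA `B`. -/
def RRConsistent {Q : Type u} {A : Type v} {Tt Ta : Type w} {γ : Type y}
    (B : BA Q A) (R : RRAlg Q A Tt Ta γ) : Prop :=
  (∀ w ∈ (ModCompl1 B R.flatten).lang, ∃ ρ κ,
      (ModCompl1 B R.flatten).AccRun w ρ κ ∧
      {j | (ρ j).2.isRight = true ∧ ¬ (ρ (j + 1)).2.isRight = true}.Infinite) ∧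
  (∀ w ρ κ, (ModCompl1 B R.flatten).AccRun w ρ κ → ∀ i : ℕ,
      (i = 0 ∨ (ρ (i - 1)).2.isLeft = true) →
      ((∃ ρ' κ', (ModCompl1 B R.flatten).AccRun w ρ' κ' ∧
          (∀ j < i, ρ' j = ρ j) ∧ (ρ' i).2.isLeft = true) ∧
       (∃ ρ'' κ'', (ModCompl1 B R.flatten).AccRun w ρ'' κ'' ∧
          (∀ j < i, ρ'' j = ρ j) ∧ (ρ'' i).2.isRight = true))) ∧
  (∀ w ρ κ, (ModCompl1 B R.flatten).IsRun w ρ κ →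
      {j | (ρ j).2.isRight = true ∧ ¬ (ρ (j + 1)).2.isRight = true}.Infinite →
      (ModCompl1 B R.flatten).AccRun w ρ κ)

/-- A direct simulation on a BA. -/
def DirectSim {Q A : Type} (M : BA Q A) (r : Q → Q → Prop) : Prop :=
  Reflexive r ∧ Transitive r ∧
  ∀ p q, r p q → ∀ a p', (p, a, p') ∈ M.delta →
    ∃ q', (q, a, q') ∈ M.delta ∧ r p' q' ∧ ((p, a, p') ∈ M.F → (q, a, q') ∈ M.F)

/-- Pruning of a set of states w.r.t. the relation `⊑` (given as `sq`). -/
def pr {Q : Type} (sq : Q → Q → Prop) (S : Set Q) : Set Q :=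
  {p | p ∈ S ∧ ¬ ∃ q ∈ S, sq p q}

/-- The level sets of the run DAG of `M` over `w` with respect to `θ`. -/
def thetaSeq {Q A : Type} (M : BA Q A) (θ : Set Q → Set Q) (w : ℕ → A) :
    ℕ → Set Q
  | 0 => θ M.init
  | i + 1 => θ (M.deltaSet (thetaSeq M θ w i) (w i))

/-- The run DAG of `M` over `w` w.r.t. `θ` is accepting: it contains an
infinite path visiting accepting transitions infinitely often. -/
def DAGAccepting {Q A : Type} (M : BA Q A) (θ : Set Q → Set Q) (w : ℕ → A) :
    Prop :=
  ∃ π : ℕ → Q, (∀ i, π i ∈ thetaSeq M θ w i) ∧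
    (∀ i, (π i, w i, π (i + 1)) ∈ M.delta) ∧
    {i | (π i, w i, π (i + 1)) ∈ M.F}.Infinite

section PrunedRunDAG

variable {Q A : Type}

theorem pr_subset (sq : Q → Q → Prop) (S : Set Q) : pr sq S ⊆ S := fun _ hp => hp.1

theorem thetaSeq_subset_id (M : BA Q A) {θ : Set Q → Set Q} (hθ : ∀ S, θ S ⊆ S) (w : ℕ → A)
    (i : ℕ) : thetaSeq M θ w i ⊆ thetaSeq M id w i := by
  induction i with
  | zero => exact hθ _
  | succ i ih =>
    intro q hq
    obtain ⟨p, hp, hpq⟩ := hθ _ hq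
    exact ⟨p, ih hp, hpq⟩

/-- Every state of `S` is either kept by pruning or simulated by a kept state of larger rank. -/
theorem exists_mem_pr [Finite Q] {r : Q → Q → Prop}
    (htrans : ∀ ⦃x y z⦄, r x y → r y z → r x z) (h : Q → ℕ)
    {S : Set Q} {q : Q} (hq : q ∈ S) :
    q ∈ pr (fun p q => r p q ∧ h p < h q) S ∨
      ∃ q' ∈ pr (fun p q => r p q ∧ h p < h q) S, r q q' ∧ h q < h q' := by
  by_cases hmem : q ∈ pr (fun p q => r p q ∧ h p < h q) S
  · exact Or.inl hmem
  right
  have hne : {x | x ∈ S ∧ r q x ∧ h q < h x}.Nonempty := by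
    by_contra hempty
    exact hmem ⟨hq, fun ⟨x, hx, hqx⟩ => hempty ⟨x, hx, hqx⟩⟩
  obtain ⟨x, ⟨hxS, hqx, hlt⟩, hmax⟩ :=
    Set.exists_max_image _ h (Set.toFinite {x | x ∈ S ∧ r q x ∧ h q < h x}) hne
  refine ⟨x, ⟨hxS, ?_⟩, hqx, hlt⟩
  rintro ⟨y, hyS, hxy, hlt'⟩
  exact absurd (hmax y ⟨hyS, htrans hqx hxy, hlt.trans hlt'⟩) (not_le.mpr hlt')

/-- An accepting path starting at an arbitrary level of the run DAG extends backwards to an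
accepting path starting at the first level. -/
theorem DAGAccepting.of_tail {M : BA Q A} {θ : Set Q → Set Q} (hθ : ∀ S, θ S ⊆ S) {w : ℕ → A}
    (N : ℕ) (σ : ℕ → Q) (hmem : ∀ k, σ k ∈ thetaSeq M θ w (k + N))
    (hstep : ∀ k, (σ k, w (k + N), σ (k + 1)) ∈ M.delta)
    (hacc : ∀ k, ∃ j ≥ k, (σ j, w (j + N), σ (j + 1)) ∈ M.F) : DAGAccepting M θ w := by
  induction N generalizing σ with
  | zero =>
    refine ⟨σ, hmem, hstep, Set.infinite_of_forall_exists_gt fun k => ?_⟩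
    obtain ⟨j, hj, hF⟩ := hacc (k + 1)
    exact ⟨j, hF, hj⟩
  | succ N ih =>
    have h0 := hmem 0
    rw [Nat.zero_add] at h0
    obtain ⟨p, hp, hpσ⟩ := hθ _ h0
    have hshift : ∀ k, k + 1 + N = k + (N + 1) := fun k => by omega
    refine ih (fun k => Nat.casesOn k p σ) ?_ ?_ ?_
    · rintro (_ | k)
      · simpa using hp
      · rw [hshift]
        exact hmem k
    · rintro (_ | k)
      · simpa using hpσ
      · rw [hshift]
        exact hstep k
    · intro k
      obtain ⟨j, hj, hF⟩ := hacc k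
      refine ⟨j + 1, by omega, ?_⟩
      rw [hshift]
      exact hF

/-- Some state of the pruned run DAG simulates the run `ρ` and has the largest rank among all
such states, over all levels. -/
theorem exists_simulating_max_rank [Finite Q] (M : BA Q A) {r : Q → Q → Prop}
    (hr : DirectSim M r) (h : Q → ℕ) (w : ℕ → A) {ρ : ℕ → Q} (hinit : ρ 0 ∈ M.init) :
    ∃ N q, q ∈ thetaSeq M (pr fun p q => r p q ∧ h p < h q) w N ∧ r (ρ N) q ∧
      ∀ i p, p ∈ thetaSeq M (pr fun p q => r p q ∧ h p < h q) w i → r (ρ i) p → h p ≤ h q := by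
  have hne : {q | ∃ i, q ∈ thetaSeq M (pr fun p q => r p q ∧ h p < h q) w i ∧
      r (ρ i) q}.Nonempty := by
    rcases exists_mem_pr hr.2.1 h hinit with hmem | ⟨q, hq, hrq, -⟩
    · exact ⟨ρ 0, 0, hmem, hr.1 _⟩
    · exact ⟨q, 0, hq, hrq⟩
  obtain ⟨q, ⟨N, hq, hrq⟩, hmax⟩ := Set.exists_max_image _ h (Set.toFinite _) hne
  exact ⟨N, q, hq, hrq, fun i p hp hrp => hmax p ⟨i, hp, hrp⟩⟩

/-- Pruning preserves acceptance of the run DAG as soon as the rank is monotone along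
reachability. -/
theorem DAGAccepting.pr [Finite Q] {M : BA Q A} {r : Q → Q → Prop} (hr : DirectSim M r)
    {h : Q → ℕ} (hmono : ∀ p q, M.Reach p q → h p ≤ h q) {w : ℕ → A}
    (hacc : DAGAccepting M id w) :
    DAGAccepting M (pr fun p q => r p q ∧ h p < h q) w := by
  obtain ⟨ρ, hρ, hδ, hF⟩ := hacc
  obtain ⟨N, q₀, hq₀, hrq₀, hmax⟩ := exists_simulating_max_rank M hr h w (hρ 0)
  let T := thetaSeq M (_root_.pr fun p q => r p q ∧ h p < h q) w
  let P : ℕ → Q → Prop := fun k q => q ∈ T (k + N) ∧ r (ρ (k + N)) q ∧ h q₀ ≤ h q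
  have hsucc : ∀ k q, P k q → ∃ q', P (k + 1) q' ∧ (q, w (k + N), q') ∈ M.delta ∧
      ((ρ (k + N), w (k + N), ρ (k + N + 1)) ∈ M.F → (q, w (k + N), q') ∈ M.F) := by
    rintro k q ⟨hqT, hrq, hle⟩
    obtain ⟨q', hqq', hrq', hFq'⟩ := hr.2.2 _ _ hrq _ _ (hδ (k + N))
    have hle' : h q₀ ≤ h q' := hle.trans (hmono q q' (Relation.ReflTransGen.single ⟨_, hqq'⟩))
    have hshift : k + 1 + N = k + N + 1 := by omega
    have hq'S : q' ∈ M.deltaSet (T (k + N)) (w (k + N)) := ⟨q, hqT, hqq'⟩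
    rcases exists_mem_pr hr.2.1 h hq'S with hmem | ⟨x, hx, hrx, hlt⟩
    · refine ⟨q', ⟨?_, ?_, hle'⟩, hqq', hFq'⟩
      · rw [hshift]
        exact hmem
      · rw [hshift]
        exact hrq'
    · exact absurd (hmax (k + N + 1) x hx (hr.2.1 hrq' hrx)) (by omega)
  choose! f hf using hsucc
  let σ : ℕ → Q := fun k => Nat.rec q₀ f k
  have hσ : ∀ k, P k (σ k) := by
    intro k
    induction k with
    | zero =>
      refine ⟨?_, ?_, le_rfl⟩
      · rw [Nat.zero_add]
        exact hq₀
      · rw [Nat.zero_add]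
        exact hrq₀
    | succ k ih => exact (hf k (σ k) ih).1
  refine DAGAccepting.of_tail (pr_subset _) N σ (fun k => (hσ k).1)
    (fun k => (hf k (σ k) (hσ k)).2.1) fun k => ?_
  obtain ⟨j, hj, hjk⟩ := hF.exists_gt (k + N)
  obtain ⟨i, rfl⟩ : ∃ i, j = i + N := ⟨j - N, by omega⟩
  exact ⟨i, by omega, (hf i (σ i) (hσ i)).2.2 hj⟩

end PrunedRunDAG

theorem statement12 {Q A : Type} [Fintype Q] [Fintype A] [Nonempty A]
    (M : BA Q A) (r : Q → Q → Prop) (hr : DirectSim M r)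
    (h : Q → ℕ) (hsame : ∀ p q, h p = h q ↔ M.SameSCC p q)
    (hmono : ∀ p q, M.Reach p q → h p ≤ h q) (w : ℕ → A) :
    DAGAccepting M (pr (fun p q => r p q ∧ h p < h q)) w ↔
    DAGAccepting M id w := by
  refine ⟨?_, DAGAccepting.pr hr hmono⟩
  rintro ⟨π, hπ, hrun⟩
  exact ⟨π, fun i => thetaSeq_subset_id M (pr_subset _) w i (hπ i), hrun⟩
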